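/- Let K be a field, let A be a commutative K-algebra, let I be a proper ideal of A, and let B := K[I]. Then: (i) I is a maximal ideal of B, with B/I isomorphic to K as a K-algebra; (ii) a prime ideal p of A satisfies p ∩ B = I if and only if I ⊆ p, so the fiber of the contraction map Spec A → Spec B over the point I is exactly the set V(I) of primes of A containing I; (iii) the contraction map p ↦ p ∩ B is a bijection from the set of prime ideals of A not containing I onto the set of prime ideals of B different from I. -/

import Mathlib

/-- The `K`-subalgebra `K[I] = {λ·1_A + i : λ ∈ K, i ∈ I}` of `A`. -/
def kSub (K : Type*) [Field K] (A : Type*) [CommRing A] [Algebra K A]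
    (I : Ideal A) : Subalgebra K A where
  carrier := {a : A | ∃ (c : K) (i : A), i ∈ I ∧ a = algebraMap K A c + i}
  mul_mem' := by
    rintro a b ⟨c, i, hi, rfl⟩ ⟨d, j, hj, rfl⟩
    refine ⟨c * d, algebraMap K A c * j + i * algebraMap K A d + i * j,
      I.add_mem (I.add_mem (I.mul_mem_left _ hj) (I.mul_mem_right _ hi)) (I.mul_mem_right _ hi), ?_⟩
    rw [map_mul]; ring
  add_mem' := by
    rintro a b ⟨c, i, hi, rfl⟩ ⟨d, j, hj, rfl⟩
    exact ⟨c + d, i + j, I.add_mem hi hj, by rw [map_add]; ring⟩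
  one_mem' := ⟨1, 0, I.zero_mem, by simp⟩
  zero_mem' := ⟨0, 0, I.zero_mem, by simp⟩
  algebraMap_mem' := fun c => ⟨c, 0, I.zero_mem, by simp⟩

section

variable {K A : Type*} [Field K] [CommRing A] [Algebra K A] {I : Ideal A}

theorem mem_kSub_of_mem {a : A} (ha : a ∈ I) : a ∈ kSub K A I :=
  ⟨0, a, ha, by simp⟩

theorem bijective_ofId_kSub_quotient (hI : I ≠ ⊤) :
    Function.Bijective (Algebra.ofId K (kSub K A I ⧸ Ideal.comap (kSub K A I).val I)) := by
  have : Nontrivial (kSub K A I ⧸ Ideal.comap (kSub K A I).val I) :=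
    Ideal.Quotient.nontrivial_iff.mpr (Ideal.comap_ne_top _ hI)
  refine ⟨(Algebra.ofId K _).toRingHom.injective, fun x => ?_⟩
  obtain ⟨⟨b, c, i, hi, hb⟩, rfl⟩ := Ideal.Quotient.mk_surjective x
  refine ⟨c, ?_⟩
  rw [Algebra.ofId_apply, ← Ideal.Quotient.mk_algebraMap, eq_comm, Ideal.Quotient.eq,
    Ideal.mem_comap]
  simpa [hb] using hi

/-- The quotient of `K[I]` by `I` is `K`. -/
noncomputable def kSubQuotientEquiv (hI : I ≠ ⊤) :
    (kSub K A I ⧸ Ideal.comap (kSub K A I).val I) ≃ₐ[K] K :=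
  (AlgEquiv.ofBijective _ (bijective_ofId_kSub_quotient hI)).symm

theorem isMaximal_comap_kSub_val (hI : I ≠ ⊤) : (Ideal.comap (kSub K A I).val I).IsMaximal :=
  Ideal.Quotient.maximal_of_isField _
    ((kSubQuotientEquiv (K := K) hI).toMulEquiv.isField (Field.toIsField K))

theorem le_of_comap_kSub_val_le {p : Ideal A}
    (h : Ideal.comap (kSub K A I).val I ≤ Ideal.comap (kSub K A I).val p) : I ≤ p :=
  fun a ha => h (x := ⟨a, mem_kSub_of_mem ha⟩) ha

theorem comap_kSub_val_eq_iff (hI : I ≠ ⊤) {p : Ideal A} (hp : p.IsPrime) :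
    Ideal.comap (kSub K A I).val p = Ideal.comap (kSub K A I).val I ↔ I ≤ p :=
  ⟨fun h => le_of_comap_kSub_val_le h.ge, fun h =>
    ((isMaximal_comap_kSub_val hI).eq_of_le (Ideal.comap_ne_top _ hp.ne_top)
      (Ideal.comap_mono h)).symm⟩

theorem le_of_comap_kSub_val_le_of_not_le {p p' : Ideal A} (hp' : p'.IsPrime) (hIp' : ¬ I ≤ p')
    (h : Ideal.comap (kSub K A I).val p ≤ Ideal.comap (kSub K A I).val p') : p ≤ p' := by
  obtain ⟨s, hs, hsp⟩ := SetLike.not_le_iff_exists.mp hIp'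
  intro a ha
  have : a * s ∈ p' := h (x := ⟨a * s, mem_kSub_of_mem (I.mul_mem_left a hs)⟩)
    (p.mul_mem_right s ha)
  exact (hp'.mem_or_mem this).resolve_right hsp

/-- The largest ideal `p` of `A` with `p * I ⊆ q`, for `q` an ideal of `K[I]`. -/
def kSubColon (q : Ideal (kSub K A I)) : Ideal A where
  carrier := {a | ∀ (i : A) (hi : i ∈ I), (⟨a * i, mem_kSub_of_mem (I.mul_mem_left a hi)⟩ :
    kSub K A I) ∈ q}
  zero_mem' i hi := by
    convert q.zero_mem
    simp
  add_mem' {a b} ha hb i hi := by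
    convert q.add_mem (ha i hi) (hb i hi)
    simp [add_mul]
  smul_mem' c a ha i hi := by
    convert ha (c * i) (I.mul_mem_left c hi) using 2
    simp only [smul_eq_mul]
    ring

theorem comap_kSubColon {q : Ideal (kSub K A I)} (hq : q.IsPrime)
    (hIq : ¬ Ideal.comap (kSub K A I).val I ≤ q) :
    Ideal.comap (kSub K A I).val (kSubColon q) = q := by
  obtain ⟨s, hs, hsq⟩ := SetLike.not_le_iff_exists.mp hIq
  ext b
  refine ⟨fun hb => ?_, fun hb i hi => ?_⟩
  · exact (hq.mem_or_mem (show b * s ∈ q from hb s hs)).resolve_right hsq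
  · exact q.mul_mem_right ⟨i, mem_kSub_of_mem hi⟩ hb

theorem isPrime_kSubColon {q : Ideal (kSub K A I)} (hq : q.IsPrime)
    (hIq : ¬ Ideal.comap (kSub K A I).val I ≤ q) : (kSubColon q).IsPrime := by
  refine ⟨fun h => hq.ne_top ?_, fun {a b} hab => ?_⟩
  · rw [← comap_kSubColon hq hIq, h, Ideal.comap_top]
  · by_contra! hcon
    obtain ⟨ha, hb⟩ := hcon
    change ¬ ∀ (i : A) (hi : i ∈ I), _ at ha
    change ¬ ∀ (i : A) (hi : i ∈ I), _ at hb
    push Not at ha hb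
    obtain ⟨i, hi, hai⟩ := ha
    obtain ⟨j, hj, hbj⟩ := hb
    refine (hq.mem_or_mem ?_).elim hai hbj
    convert hab (i * j) (I.mul_mem_left i hj) using 1
    exact Subtype.ext (mul_mul_mul_comm a i b j)

end

/-- Let `K` be a field, `A` a commutative `K`-algebra, `I` a proper
ideal of `A`, and `B := K[I]`.  Write `J := I ∩ B` for `I` viewed as an ideal of `B`
(note `I ⊆ B`).  Then:
(i) `J` is a maximal ideal of `B` with `B/J ≅ K` as `K`-algebras;
(ii) a prime `p` of `A` satisfies `p ∩ B = J` iff `I ⊆ p`, i.e. the fiber of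
`Spec A → Spec B` over `J` is exactly `V(I)`;
(iii) `p ↦ p ∩ B` is a bijection from the primes of `A` not containing `I` onto the
primes of `B` different from `J`. -/
theorem kSub_spec_contraction
    (K : Type*) [Field K] (A : Type*) [CommRing A] [Algebra K A]
    (I : Ideal A) (hI : I ≠ ⊤) :
    (Ideal.comap (kSub K A I).val I).IsMaximal ∧
    Nonempty ((kSub K A I ⧸ Ideal.comap (kSub K A I).val I) ≃ₐ[K] K) ∧
    (∀ p : Ideal A, p.IsPrime →
      (Ideal.comap (kSub K A I).val p = Ideal.comap (kSub K A I).val I ↔ I ≤ p)) ∧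
    Set.BijOn (fun p : Ideal A => Ideal.comap (kSub K A I).val p)
      {p : Ideal A | p.IsPrime ∧ ¬ I ≤ p}
      {q : Ideal (kSub K A I) | q.IsPrime ∧ q ≠ Ideal.comap (kSub K A I).val I} := by
  refine ⟨isMaximal_comap_kSub_val hI, ⟨kSubQuotientEquiv hI⟩,
    fun p hp => comap_kSub_val_eq_iff hI hp, ?_, ?_, ?_⟩
  · rintro p ⟨hp, hIp⟩
    exact ⟨hp.comap _, fun h => hIp ((comap_kSub_val_eq_iff hI hp).mp h)⟩
  · rintro p ⟨hp, hIp⟩ p' ⟨hp', hIp'⟩ h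
    exact le_antisymm (le_of_comap_kSub_val_le_of_not_le hp' hIp' h.le)
      (le_of_comap_kSub_val_le_of_not_le hp hIp h.ge)
  · rintro q ⟨hq, hne⟩
    have hIq : ¬ Ideal.comap (kSub K A I).val I ≤ q := fun h =>
      hne ((isMaximal_comap_kSub_val hI).eq_of_le hq.ne_top h).symm
    have hcomap := comap_kSubColon hq hIq
    exact ⟨kSubColon q, ⟨isPrime_kSubColon hq hIq, fun h =>
      hIq (hcomap ▸ Ideal.comap_mono h)⟩, hcomap⟩
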